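/- Geometric structure of the occupation measure set: Let (S, A, P) be a weakly communicating MDP with finite state space S and finite action space A, and let s₁ ∈ S be any initial state. Then the relative interior of the flow polytope is contained in the occupation measure set, the extreme points of the flow polytope are contained in the occupation measure set, and the occupation measure set is contained in the flow polytope: relint(𝓟) ⊆ Q(s₁), ext(𝓟) ⊆ Q(s₁), and Q(s₁) ⊆ 𝓟. -/

import Mathlib

open Finset Filter Topology

noncomputable section

/-- `P` is a transition kernel: nonnegative and each row sums to one. -/
def IsKernel {S A : Type*} [Fintype S] (P : S → A → S → ℝ) : Prop :=
  (∀ s a s', 0 ≤ P s a s') ∧ ∀ s a, ∑ s', P s a s' = 1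

/-- `π` is a stationary randomized policy. -/
def IsPolicy {S A : Type*} [Fintype A] (π : S → A → ℝ) : Prop :=
  (∀ s a, 0 ≤ π s a) ∧ ∀ s, ∑ a, π s a = 1

/-- The Markov matrix induced by policy `π` on kernel `P`. -/
def markovMatrix {S A : Type*} [Fintype A] (P : S → A → S → ℝ) (π : S → A → ℝ) :
    Matrix S S ℝ :=
  fun s s' => ∑ a, π s a * P s a s'

/-- `C` is closed under the Markov matrix `M`. -/
def IsClosedClass {S : Type*} (M : Matrix S S ℝ) (C : Set S) : Prop :=
  ∀ s ∈ C, ∀ s' ∉ C, M s s' = 0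

/-- `C` is irreducible under the Markov matrix `M`. -/
def IsIrreducibleOn {S : Type*} [Fintype S] [DecidableEq S] (M : Matrix S S ℝ)
    (C : Set S) : Prop :=
  ∀ s ∈ C, ∀ s' ∈ C, ∃ n : ℕ, 0 < (M ^ n) s s'

/-- `s` is a transient state under the Markov matrix `M`. -/
def IsTransient {S : Type*} [Fintype S] [DecidableEq S] (M : Matrix S S ℝ) (s : S) : Prop :=
  Summable fun n : ℕ => (M ^ (n + 1)) s s

/-- The MDP `(S, A, P)` is weakly communicating. -/
def WeaklyCommunicating {S A : Type*} [Fintype S] [DecidableEq S] [Fintype A]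
    (P : S → A → S → ℝ) : Prop :=
  ∃ (π : S → A → ℝ) (C : Set S), IsPolicy π ∧ C.Nonempty ∧
    IsClosedClass (markovMatrix P π) C ∧ IsIrreducibleOn (markovMatrix P π) C ∧
    ∀ s ∉ C, ∀ π' : S → A → ℝ, IsPolicy π' → IsTransient (markovMatrix P π') s

/-- `q` is the occupation measure of the policy `π` from initial state `s₁`:
the Cesàro averages `(1/T) ∑_{t=1}^T (P_π^{t-1})(s₁,s) ⬝ π s a` converge to `q (s,a)`. -/
def IsOccupation {S A : Type*} [Fintype S] [DecidableEq S] [Fintype A]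
    (P : S → A → S → ℝ) (π : S → A → ℝ) (s₁ : S) (q : S × A → ℝ) : Prop :=
  ∀ s a, Tendsto
    (fun T : ℕ => (1 / (T : ℝ)) * ∑ t ∈ Finset.range T, ((markovMatrix P π) ^ t) s₁ s * π s a)
    atTop (𝓝 (q (s, a)))

/-- `Q(s₁)`: the set of occupation measures of stationary policies from `s₁`. -/
def occSet {S A : Type*} [Fintype S] [DecidableEq S] [Fintype A]
    (P : S → A → S → ℝ) (s₁ : S) : Set (S × A → ℝ) :=
  {q | ∃ π : S → A → ℝ, IsPolicy π ∧ IsOccupation P π s₁ q}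

/-- `c·q = ∑_{(s,a)} c(s,a) q(s,a)`. -/
def dotSA {S A : Type*} [Fintype S] [Fintype A] (c q : S × A → ℝ) : ℝ :=
  ∑ p, c p * q p

/-- The dual function `D(λ) = sup { r·q + λ(g·q − b) : q ∈ Q(s₁) }`. -/
def dualFn {S A : Type*} [Fintype S] [DecidableEq S] [Fintype A]
    (P : S → A → S → ℝ) (s₁ : S) (r g : S × A → ℝ) (b : ℝ) (lam : ℝ) : ℝ :=
  sSup {x | ∃ q ∈ occSet P s₁, x = dotSA r q + lam * (dotSA g q - b)}

/-- The flow polytope `𝓟`. -/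
def flowPolytope {S A : Type*} [Fintype S] [Fintype A] (P : S → A → S → ℝ) :
    Set (S × A → ℝ) :=
  {q | (∀ p, 0 ≤ q p) ∧ (∑ p, q p = 1) ∧
    ∀ s, ∑ a, q (s, a) = ∑ p : S × A, P p.1 p.2 s * q p}

section MarkovChain

variable {S : Type*} [Fintype S]

/-- `ν` is a stationary distribution of the matrix `M`. -/
def IsStationaryDist (M : Matrix S S ℝ) (ν : S → ℝ) : Prop :=
  ν ∈ stdSimplex ℝ S ∧ ∀ s, ∑ x, ν x * M x s = ν s

/-- A stationary distribution charges every successor of a state it charges. -/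
lemma IsStationaryDist.eq_zero_of_pos {M : Matrix S S ℝ} {ν : S → ℝ} (hν : IsStationaryDist M ν)
    (hM : ∀ x y, 0 ≤ M x y) {x s : S} (hs : ν s = 0) (hx : 0 < M x s) : ν x = 0 := by
  have h := hν.2 s
  rw [hs, Finset.sum_eq_zero_iff_of_nonneg fun y _ => mul_nonneg (hν.1.1 y) (hM y s)] at h
  exact (mul_eq_zero.1 (h x (mem_univ x))).resolve_right hx.ne'

variable [DecidableEq S]

lemma IsStationaryDist.sum_mul_pow {M : Matrix S S ℝ} {ν : S → ℝ} (hν : IsStationaryDist M ν) (n : ℕ)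
    (s : S) : ∑ x, ν x * (M ^ n) x s = ν s := by
  have h1 : Matrix.vecMul ν M = ν := funext hν.2
  have h : Matrix.vecMul ν (M ^ n) = ν := by
    induction n with
    | zero => simp
    | succ n ih => rw [pow_succ, ← Matrix.vecMul_vecMul, ih, h1]
  exact congrFun h s

/-- The expected number of visits to `s` is maximal when starting from `s`. -/
lemma sum_pow_le_sum_pow_diag {M : Matrix S S ℝ} (hM : M ∈ Matrix.rowStochastic ℝ S) (N : ℕ)
    (x s : S) : ∑ t ∈ range N, (M ^ t) x s ≤ ∑ t ∈ range N, (M ^ t) s s := by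
  have hpow : ∀ n y, 0 ≤ (M ^ n) y s := fun n y =>
    Matrix.nonneg_of_mem_rowStochastic (pow_mem hM n)
  induction N generalizing x with
  | zero => simp
  | succ N ih =>
    rcases eq_or_ne x s with rfl | hxs
    · exact le_rfl
    calc ∑ t ∈ range (N + 1), (M ^ t) x s
        = ∑ t ∈ range N, ∑ y, M x y * (M ^ t) y s := by
          rw [sum_range_succ']
          simp [pow_succ', Matrix.mul_apply, Matrix.one_apply_ne hxs]
      _ = ∑ y, M x y * ∑ t ∈ range N, (M ^ t) y s := by
          rw [sum_comm]; simp_rw [mul_sum]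
      _ ≤ ∑ y, M x y * ∑ t ∈ range N, (M ^ t) s s :=
          sum_le_sum fun y _ => mul_le_mul_of_nonneg_left (ih y)
            (Matrix.nonneg_of_mem_rowStochastic hM)
      _ = ∑ t ∈ range N, (M ^ t) s s := by
          rw [← sum_mul, Matrix.sum_row_of_mem_rowStochastic hM, one_mul]
      _ ≤ _ := by
          rw [sum_range_succ]
          exact le_add_of_nonneg_right (hpow _ _)

/-- A stationary distribution does not charge transient states. -/
lemma IsStationaryDist.eq_zero_of_isTransient {M : Matrix S S ℝ} (hM : M ∈ Matrix.rowStochastic ℝ S)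
    {ν : S → ℝ} (hν : IsStationaryDist M ν) {s : S} (hs : IsTransient M s) : ν s = 0 := by
  have hs' : Summable fun n => (M ^ n) s s := (summable_nat_add_iff 1).1 hs
  have hb : ∀ N : ℕ, N * ν s ≤ ∑' n, (M ^ n) s s := fun N => calc
    N * ν s = ∑ t ∈ range N, ∑ x, ν x * (M ^ t) x s := by
        simp [hν.sum_mul_pow]
    _ = ∑ x, ν x * ∑ t ∈ range N, (M ^ t) x s := by
        rw [sum_comm]; simp_rw [mul_sum]
    _ ≤ ∑ x, ν x * ∑ t ∈ range N, (M ^ t) s s :=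
        sum_le_sum fun x _ => mul_le_mul_of_nonneg_left (sum_pow_le_sum_pow_diag hM N x s)
          (hν.1.1 x)
    _ = ∑ t ∈ range N, (M ^ t) s s := by rw [← sum_mul, hν.1.2, one_mul]
    _ ≤ _ := hs'.sum_le_tsum _ fun n _ => Matrix.nonneg_of_mem_rowStochastic (pow_mem hM n)
  by_contra h
  have hpos : 0 < ν s := lt_of_le_of_ne (hν.1.1 s) (Ne.symm h)
  obtain ⟨N, hN⟩ := exists_nat_gt ((∑' n, (M ^ n) s s) / ν s)
  exact absurd (hb N) (not_le.2 ((div_lt_iff₀ hpos).1 hN))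

/-- In a closed irreducible class, a predecessor-closed property holding somewhere holds
everywhere. -/
lemma IsIrreducibleOn.forall_of_predecessor {M : Matrix S S ℝ}
    (hM : M ∈ Matrix.rowStochastic ℝ S) {C : Set S} (hC : IsClosedClass M C)
    (hirr : IsIrreducibleOn M C) {Z : S → Prop}
    (hZ : ∀ x ∈ C, ∀ y ∈ C, 0 < M x y → Z y → Z x) {s : S} (hs : s ∈ C) (hZs : Z s) :
    ∀ x ∈ C, Z x := by
  have key : ∀ n : ℕ, ∀ x ∈ C, 0 < (M ^ n) x s → Z x := by
    intro n
    induction n with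
    | zero =>
      intro x _ hpos
      rcases eq_or_ne x s with rfl | hxs
      · exact hZs
      · simp [Matrix.one_apply_ne hxs] at hpos
    | succ n ih =>
      intro x hx hpos
      rw [pow_succ', Matrix.mul_apply] at hpos
      obtain ⟨y, -, hy⟩ := exists_lt_of_sum_lt (s := univ) (f := fun _ : S => (0 : ℝ))
        (by simpa using hpos)
      have hxy : 0 < M x y := lt_of_le_of_ne (Matrix.nonneg_of_mem_rowStochastic hM)
        fun h => by simp [← h] at hy
      have hyC : y ∈ C := by
        by_contra h
        exact hxy.ne' (hC x hx y h)
      exact hZ x hx y hyC hxy (ih y hyC (pos_of_mul_pos_right hy hxy.le))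
  intro x hx
  obtain ⟨n, hn⟩ := hirr x hx s hs
  exact key n x hx hn

/-- If `μ` and `ν` are stationary, then `ν`-charged states outside the support of `μ` do not lead
into the support of `μ`. -/
lemma IsStationaryDist.apply_eq_zero {M : Matrix S S ℝ} (hM : M ∈ Matrix.rowStochastic ℝ S)
    {μ ν : S → ℝ} (hμ : IsStationaryDist M μ) (hν : IsStationaryDist M ν) {x y : S} (hx : μ x = 0)
    (hy : μ y ≠ 0) (hνx : ν x ≠ 0) : M x y = 0 := by
  have hM0 : ∀ x y, 0 ≤ M x y := fun x y => Matrix.nonneg_of_mem_rowStochastic hM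
  have hclosed : ∀ x y, μ x ≠ 0 → μ y = 0 → M x y = 0 := fun x y hx hy =>
    (hM0 x y).antisymm' (not_lt.1 fun h => hx (hμ.eq_zero_of_pos hM0 hy h))
  have hrow : ∀ x, 1 - ∑ z with μ z = 0, M x z = ∑ z with μ z ≠ 0, M x z := fun x => by
    rw [← Matrix.sum_row_of_mem_rowStochastic hM x,
      ← sum_filter_add_sum_filter_not univ (fun z => μ z = 0)]
    ring
  have h1 : ∑ z with μ z = 0, ν z = ∑ x with μ x = 0, ν x * ∑ z with μ z = 0, M x z := by
    calc ∑ z with μ z = 0, ν z = ∑ z with μ z = 0, ∑ x, ν x * M x z :=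
          sum_congr rfl fun z _ => (hν.2 z).symm
      _ = ∑ x, ν x * ∑ z with μ z = 0, M x z := by rw [sum_comm]; simp_rw [mul_sum]
      _ = _ := by
        rw [sum_filter_of_ne]
        intro x _ h
        by_contra hx
        refine h ?_
        rw [sum_eq_zero fun z hz => hclosed x z hx (mem_filter.1 hz).2, mul_zero]
  have h2 : ∑ x with μ x = 0, ν x * ∑ z with μ z ≠ 0, M x z = 0 := by
    simp_rw [← hrow, mul_sub, mul_one, sum_sub_distrib]
    linarith
  rw [sum_eq_zero_iff_of_nonneg fun x _ =>
    mul_nonneg (hν.1.1 x) (sum_nonneg fun z _ => hM0 x z)] at h2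
  have h3 := (mul_eq_zero.1 (h2 x (by simp [hx]))).resolve_left hνx
  rw [sum_eq_zero_iff_of_nonneg fun z _ => hM0 x z] at h3
  exact h3 y (by simp [hy])

/-- The Cesàro average of the first `T` state distributions of the chain started at `s`. -/
def cesaroAverage (M : Matrix S S ℝ) (s : S) (T : ℕ) : S → ℝ :=
  fun x => 1 / (T : ℝ) * ∑ t ∈ range T, (M ^ t) s x

lemma cesaroAverage_mem_stdSimplex {M : Matrix S S ℝ} (hM : M ∈ Matrix.rowStochastic ℝ S) (s : S)
    {T : ℕ} (hT : T ≠ 0) : cesaroAverage M s T ∈ stdSimplex ℝ S := by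
  refine ⟨fun x => mul_nonneg (by positivity) (sum_nonneg fun t _ =>
    Matrix.nonneg_of_mem_rowStochastic (pow_mem hM t)), ?_⟩
  simp only [cesaroAverage]
  rw [← mul_sum, sum_comm]
  simp [fun t => Matrix.sum_row_of_mem_rowStochastic (pow_mem hM t) s, hT]

lemma tendsto_cesaroAverage_sub {M : Matrix S S ℝ} (hM : M ∈ Matrix.rowStochastic ℝ S) (s x : S) :
    Tendsto (fun T => ∑ y, cesaroAverage M s T y * M y x - cesaroAverage M s T x) atTop
      (𝓝 0) := by
  have h : ∀ T : ℕ, ∑ y, cesaroAverage M s T y * M y x - cesaroAverage M s T x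
      = 1 / (T : ℝ) * ((M ^ T) s x - (M ^ 0) s x) := fun T => by
    rw [← sum_range_sub (fun t => (M ^ t) s x), sum_sub_distrib, mul_sub]
    congr 1
    simp only [cesaroAverage, pow_succ, Matrix.mul_apply]
    rw [sum_comm, mul_sum]
    simp_rw [mul_assoc, sum_mul]
  simp_rw [h]
  refine squeeze_zero_norm (a := fun T : ℕ => 1 / (T : ℝ)) (fun T => ?_)
    tendsto_one_div_atTop_nhds_zero_nat
  have hT := pow_mem hM T
  have h0 := pow_mem hM 0
  rw [norm_mul, Real.norm_of_nonneg (by positivity : (0 : ℝ) ≤ 1 / (T : ℝ))]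
  refine mul_le_of_le_one_right (by positivity) (abs_le.2 ⟨?_, ?_⟩) <;>
  linarith [Matrix.nonneg_of_mem_rowStochastic hT (i := s) (j := x),
    Matrix.le_one_of_mem_rowStochastic hT (i := s) (j := x),
    Matrix.nonneg_of_mem_rowStochastic h0 (i := s) (j := x),
    Matrix.le_one_of_mem_rowStochastic h0 (i := s) (j := x)]

/-- Cluster points of the Cesàro averages are stationary. -/
lemma isStationaryDist_of_mapClusterPt {M : Matrix S S ℝ} (hM : M ∈ Matrix.rowStochastic ℝ S) (s : S)
    {ν : S → ℝ} (hν : ν ∈ stdSimplex ℝ S) (h : MapClusterPt ν atTop (cesaroAverage M s)) :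
    IsStationaryDist M ν := by
  refine ⟨hν, fun x => sub_eq_zero.1 ?_⟩
  have hc : Continuous fun v : S → ℝ => ∑ y, v y * M y x - v x := by fun_prop
  have hcl := h.continuousAt_comp hc.continuousAt
  exact eq_of_nhds_neBot (ClusterPt.mono hcl (tendsto_cesaroAverage_sub hM s x))

lemma eventually_cesaroAverage_mem {M : Matrix S S ℝ} (hM : M ∈ Matrix.rowStochastic ℝ S) (s : S) :
    ∀ᶠ T in atTop, cesaroAverage M s T ∈ stdSimplex ℝ S :=
  (eventually_ne_atTop 0).mono fun _ => cesaroAverage_mem_stdSimplex hM s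

lemma exists_isStationaryDist [Nonempty S] {M : Matrix S S ℝ} (hM : M ∈ Matrix.rowStochastic ℝ S) :
    ∃ ν, IsStationaryDist M ν := by
  obtain ⟨s⟩ := ‹Nonempty S›
  obtain ⟨ν, hν, h⟩ := (isCompact_stdSimplex ℝ S).exists_mapClusterPt_of_frequently
    (eventually_cesaroAverage_mem hM s).frequently
  exact ⟨ν, isStationaryDist_of_mapClusterPt hM s hν h⟩

/-- If the stationary distribution is unique, the Cesàro averages converge to it. -/
lemma tendsto_cesaroAverage {M : Matrix S S ℝ} (hM : M ∈ Matrix.rowStochastic ℝ S) (s : S)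
    {μ : S → ℝ} (h : ∀ ν, IsStationaryDist M ν → ν = μ) :
    Tendsto (cesaroAverage M s) atTop (𝓝 μ) :=
  (isCompact_stdSimplex ℝ S).tendsto_nhds_of_unique_mapClusterPt
    (eventually_cesaroAverage_mem hM s) fun ν hν hc => h ν (isStationaryDist_of_mapClusterPt hM s hν hc)

end MarkovChain

section FlowPolytope

variable {S A : Type*} [Fintype S] [Fintype A]

lemma markovMatrix_mem_rowStochastic [DecidableEq S] {P : S → A → S → ℝ} (hP : IsKernel P)
    {π : S → A → ℝ} (hπ : IsPolicy π) : markovMatrix P π ∈ Matrix.rowStochastic ℝ S := by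
  refine Matrix.mem_rowStochastic_iff_sum.2
    ⟨fun s s' => sum_nonneg fun a _ => mul_nonneg (hπ.1 s a) (hP.1 s a s'), fun s => ?_⟩
  simp only [markovMatrix]
  rw [sum_comm]
  simp [← mul_sum, hP.2, hπ.2]

lemma IsStationaryDist.mul_mem_flowPolytope {P : S → A → S → ℝ} {π : S → A → ℝ} (hπ : IsPolicy π)
    {ν : S → ℝ} (hν : IsStationaryDist (markovMatrix P π) ν) :
    (fun p : S × A => ν p.1 * π p.1 p.2) ∈ flowPolytope P := by
  refine ⟨fun p => mul_nonneg (hν.1.1 _) (hπ.1 _ _), ?_, fun s => ?_⟩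
  · simp [Fintype.sum_prod_type, ← mul_sum, hπ.2, hν.1.2]
  · simp only [Fintype.sum_prod_type]
    rw [← mul_sum, hπ.2, mul_one, ← hν.2 s]
    simp only [markovMatrix, mul_sum]
    exact sum_congr rfl fun x _ => sum_congr rfl fun a _ => by ring

lemma isStationaryDist_of_mem_flowPolytope {P : S → A → S → ℝ} {q : S × A → ℝ}
    (hq : q ∈ flowPolytope P) {π : S → A → ℝ}
    (hqπ : ∀ s a, q (s, a) = (∑ b, q (s, b)) * π s a) :
    IsStationaryDist (markovMatrix P π) fun s => ∑ a, q (s, a) := by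
  refine ⟨⟨fun s => sum_nonneg fun a _ => hq.1 _, ?_⟩, fun s => ?_⟩
  · simpa [Fintype.sum_prod_type] using hq.2.1
  · beta_reduce
    rw [hq.2.2 s, Fintype.sum_prod_type]
    simp only [markovMatrix, mul_sum]
    refine sum_congr rfl fun x _ => sum_congr rfl fun a _ => ?_
    rw [← mul_assoc, ← hqπ, mul_comm]

lemma isOccupation_iff [DecidableEq S] {P : S → A → S → ℝ} {π : S → A → ℝ} {s₁ : S}
    {q : S × A → ℝ} : IsOccupation P π s₁ q ↔ ∀ s a,
      Tendsto (fun T => cesaroAverage (markovMatrix P π) s₁ T s * π s a) atTop (𝓝 (q (s, a))) := by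
  simp only [IsOccupation, cesaroAverage, ← sum_mul, mul_assoc]

lemma occSet_subset_flowPolytope [DecidableEq S] {P : S → A → S → ℝ} (hP : IsKernel P) (s₁ : S) :
    occSet P s₁ ⊆ flowPolytope P := by
  rintro q ⟨π, hπ, hq⟩
  rw [isOccupation_iff] at hq
  have hM := markovMatrix_mem_rowStochastic hP hπ
  have hlim : Tendsto (cesaroAverage (markovMatrix P π) s₁) atTop
      (𝓝 fun s => ∑ a, q (s, a)) := by
    refine tendsto_pi_nhds.2 fun s => ?_
    simpa [← mul_sum, hπ.2] using tendsto_finsetSum univ fun a _ => hq s a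
  have hμ := isStationaryDist_of_mapClusterPt hM s₁
    ((isClosed_stdSimplex ℝ S).mem_of_tendsto hlim (eventually_cesaroAverage_mem hM s₁))
    hlim.mapClusterPt
  convert hμ.mul_mem_flowPolytope hπ with p
  exact tendsto_nhds_unique (hq p.1 p.2) ((tendsto_pi_nhds.1 hlim p.1).mul_const _)

/-- The conditional action distribution of `q` given the state, completed by `π` at states of zero
mass. -/
def conditionalPolicy (π : S → A → ℝ) (q : S × A → ℝ) : S → A → ℝ :=
  fun s a => if ∑ b, q (s, b) = 0 then π s a else q (s, a) / ∑ b, q (s, b)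

lemma isPolicy_conditionalPolicy {S A : Type*} [Fintype A] {π : S → A → ℝ} (hπ : IsPolicy π)
    {q : S × A → ℝ} (hq : ∀ p, 0 ≤ q p) : IsPolicy (conditionalPolicy π q) := by
  constructor
  · intro s a
    unfold conditionalPolicy
    split_ifs
    exacts [hπ.1 s a, div_nonneg (hq _) (sum_nonneg fun _ _ => hq _)]
  · intro s
    unfold conditionalPolicy
    split_ifs with h
    exacts [hπ.2 s, by rw [← sum_div, div_self h]]

lemma eq_mul_conditionalPolicy {S A : Type*} [Fintype A] (π : S → A → ℝ) {q : S × A → ℝ}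
    (hq : ∀ p, 0 ≤ q p) (s : S) (a : A) : q (s, a) = (∑ b, q (s, b)) * conditionalPolicy π q s a := by
  unfold conditionalPolicy
  split_ifs with h
  · rw [h, zero_mul]
    exact (sum_eq_zero_iff_of_nonneg fun b _ => hq (s, b)).1 h a (mem_univ a)
  · rw [mul_div_cancel₀ _ h]

lemma mem_occSet_of_unique [DecidableEq S] {P : S → A → S → ℝ} (hP : IsKernel P)
    {π : S → A → ℝ} (hπ : IsPolicy π) {q : S × A → ℝ} (hq : q ∈ flowPolytope P) (s₁ : S)
    (h : ∀ ν, IsStationaryDist (markovMatrix P (conditionalPolicy π q)) ν →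
      ν = fun s => ∑ a, q (s, a)) : q ∈ occSet P s₁ := by
  have hπq := isPolicy_conditionalPolicy hπ hq.1
  refine ⟨_, hπq, isOccupation_iff.2 fun s a => ?_⟩
  rw [eq_mul_conditionalPolicy π hq.1 s a]
  exact (tendsto_pi_nhds.1 (tendsto_cesaroAverage (markovMatrix_mem_rowStochastic hP hπq) s₁ h)
    s).mul_const _

/-- Stationary distributions of the completed conditional policy of `q` charge only states of
positive `q`-mass. -/
lemma IsStationaryDist.eq_zero_of_sum_eq_zero [DecidableEq S] {P : S → A → S → ℝ} (hP : IsKernel P)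
    {π : S → A → ℝ} (hπ : IsPolicy π) {C : Set S} (hC : IsClosedClass (markovMatrix P π) C)
    (hirr : IsIrreducibleOn (markovMatrix P π) C)
    (htr : ∀ s ∉ C, ∀ π' : S → A → ℝ, IsPolicy π' → IsTransient (markovMatrix P π') s)
    {q : S × A → ℝ} (hq : q ∈ flowPolytope P) {ν : S → ℝ}
    (hν : IsStationaryDist (markovMatrix P (conditionalPolicy π q)) ν) {s : S}
    (hs : ∑ a, q (s, a) = 0) : ν s = 0 := by
  have hπq := isPolicy_conditionalPolicy hπ hq.1
  have hM := markovMatrix_mem_rowStochastic hP hπq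
  have hμ := isStationaryDist_of_mem_flowPolytope hq (eq_mul_conditionalPolicy π hq.1)
  by_cases hsC : s ∈ C
  swap
  · exact hν.eq_zero_of_isTransient hM (htr s hsC _ hπq)
  obtain ⟨b, hb⟩ : ∃ b, ∑ a, q (b, a) ≠ 0 := by
    by_contra! h
    have := hμ.1.2
    simp [h] at this
  have hbC : b ∈ C := by
    by_contra h
    exact hb (hμ.eq_zero_of_isTransient hM (htr b h _ hπq))
  refine (hirr.forall_of_predecessor (markovMatrix_mem_rowStochastic hP hπ) hC
    (Z := fun x => ν x = 0 ∨ ∑ a, q (x, a) ≠ 0) ?_ hbC (Or.inr hb) s hsC).resolve_right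
    (not_not.2 hs)
  intro x _ y _ hxy hy
  by_contra! hx
  have hrow : markovMatrix P (conditionalPolicy π q) x y = markovMatrix P π x y := by
    simp [markovMatrix, conditionalPolicy, hx.2]
  rw [← hrow] at hxy
  rcases hy with hy | hy
  · exact hx.1 (hν.eq_zero_of_pos (fun _ _ => Matrix.nonneg_of_mem_rowStochastic hM) hy hxy)
  · exact hxy.ne' (hμ.apply_eq_zero hM hν hx.2 hy hx.1)

/-- An extreme point of the flow polytope, a multiple of which dominates a point `r` of the polytope,
equals `r`: otherwise it would be a proper convex combination of `r` and a further point. -/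
lemma eq_of_mem_extremePoints_of_le {P : S → A → S → ℝ} {q r : S × A → ℝ}
    (hq : q ∈ Set.extremePoints ℝ (flowPolytope P)) (hr : r ∈ flowPolytope P) {K : ℝ} (hK : 1 < K)
    (h : ∀ p, r p ≤ K * q p) : r = q := by
  rw [mem_extremePoints_iff_left] at hq
  have hK0 : 0 < K - 1 := by linarith
  refine hq.2 r hr (fun p => (K * q p - r p) / (K - 1)) ⟨?_, ?_, ?_⟩
    ⟨1 / K, (K - 1) / K, by positivity, by positivity, by field_simp; ring, ?_⟩
  · exact fun p => div_nonneg (sub_nonneg.2 (h p)) hK0.le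
  · rw [← sum_div, sum_sub_distrib, ← mul_sum, hq.1.2.1, hr.2.1, mul_one, div_self hK0.ne']
  · intro s
    simp only [mul_div_assoc', ← sum_div, mul_sub, sum_sub_distrib, mul_left_comm _ K, ← mul_sum]
    rw [hq.1.2.2 s, hr.2.2 s]
  · funext p
    simp only [Pi.add_apply, Pi.smul_apply, smul_eq_mul]
    field_simp
    ring

lemma exists_pos_mul_le_of_mem_intrinsicInterior {P : S → A → S → ℝ} {q r : S × A → ℝ}
    (hq : q ∈ intrinsicInterior ℝ (flowPolytope P)) (hr : r ∈ flowPolytope P) :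
    ∃ ε > 0, ∀ p, ε * r p ≤ q p := by
  obtain ⟨y, hy, rfl⟩ := mem_intrinsicInterior.1 hq
  have hmem : ∀ t : ℝ, AffineMap.lineMap (y : S × A → ℝ) r t ∈ affineSpan ℝ (flowPolytope P) :=
    fun t => AffineMap.lineMap_mem t y.2 (subset_affineSpan ℝ _ hr)
  let f : ℝ → affineSpan ℝ (flowPolytope P) := fun t => ⟨_, hmem t⟩
  have hf : Continuous f :=
    AffineMap.lineMap_continuous.subtype_mk hmem
  have hf0 : f 0 = y := Subtype.ext (by simp [f])
  have hev : ∀ᶠ t in 𝓝 (0 : ℝ), f t ∈ Subtype.val ⁻¹' flowPolytope P :=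
    hf.continuousAt.eventually (by rw [hf0]; exact mem_interior_iff_mem_nhds.1 hy)
  obtain ⟨δ, hδ, hball⟩ := Metric.eventually_nhds_iff.1 hev
  have ht : f (-(δ / 2)) ∈ Subtype.val ⁻¹' flowPolytope P :=
    hball (by rw [dist_zero_right, norm_neg, Real.norm_of_nonneg (by positivity)]; linarith)
  refine ⟨δ / 2 / (1 + δ / 2), by positivity, fun p => ?_⟩
  have hp := ht.1 p
  simp only [f, AffineMap.lineMap_apply_module, Pi.add_apply, Pi.smul_apply, smul_eq_mul] at hp
  rw [div_mul_eq_mul_div, div_le_iff₀ (by positivity)]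
  linarith

lemma extremePoints_subset_occSet [DecidableEq S] {P : S → A → S → ℝ} (hP : IsKernel P)
    (hwc : WeaklyCommunicating P) (s₁ : S) :
    Set.extremePoints ℝ (flowPolytope P) ⊆ occSet P s₁ := by
  obtain ⟨π, C, hπ, -, hC, hirr, htr⟩ := hwc
  intro q hq
  have hqP : q ∈ flowPolytope P := hq.1
  refine mem_occSet_of_unique hP hπ hqP s₁ fun ν hν => ?_
  have hπq := isPolicy_conditionalPolicy hπ hqP.1
  have hμ0 : ∀ s, 0 ≤ ∑ a, q (s, a) := fun s => sum_nonneg fun a _ => hqP.1 _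
  have hratio : ∀ s, 0 ≤ ν s / ∑ a, q (s, a) := fun s => div_nonneg (hν.1.1 s) (hμ0 s)
  have hle : ∀ s, ν s ≤ (2 + ∑ x, ν x / ∑ a, q (x, a)) * ∑ a, q (s, a) := fun s => by
    rcases (hμ0 s).eq_or_lt' with h | h
    · rw [hν.eq_zero_of_sum_eq_zero hP hπ hC hirr htr hqP h, h, mul_zero]
    · rw [← div_le_iff₀ h]
      linarith [single_le_sum (fun x _ => hratio x) (mem_univ s)]
  have heq := eq_of_mem_extremePoints_of_le hq (hν.mul_mem_flowPolytope hπq)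
    (K := 2 + ∑ x, ν x / ∑ a, q (x, a)) (by linarith [sum_nonneg fun x (_ : x ∈ univ) => hratio x])
    fun ⟨s, a⟩ => by
      rw [eq_mul_conditionalPolicy π hqP.1 s a, ← mul_assoc]
      exact mul_le_mul_of_nonneg_right (hle s) (hπq.1 s a)
  funext s
  calc ν s = ∑ a, ν s * conditionalPolicy π q s a := by rw [← mul_sum, hπq.2, mul_one]
    _ = ∑ a, q (s, a) := sum_congr rfl fun a _ => congrFun heq (s, a)

lemma intrinsicInterior_subset_occSet [DecidableEq S] {P : S → A → S → ℝ} (hP : IsKernel P)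
    (hwc : WeaklyCommunicating P) (s₁ : S) :
    intrinsicInterior ℝ (flowPolytope P) ⊆ occSet P s₁ := by
  obtain ⟨π, C, hπ, hCne, hC, hirr, htr⟩ := hwc
  intro q hq
  have hqP : q ∈ flowPolytope P := intrinsicInterior_subset hq
  refine mem_occSet_of_unique hP hπ hqP s₁ fun ν hν => ?_
  have hπq := isPolicy_conditionalPolicy hπ hqP.1
  have hM₀ := markovMatrix_mem_rowStochastic hP hπ
  have hM := markovMatrix_mem_rowStochastic hP hπq
  have hμ := isStationaryDist_of_mem_flowPolytope hqP (eq_mul_conditionalPolicy π hqP.1)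
  set M := markovMatrix P (conditionalPolicy π q)
  set μ : S → ℝ := fun s => ∑ a, q (s, a)
  have : Nonempty S := ⟨s₁⟩
  obtain ⟨μ₀, hμ₀⟩ := exists_isStationaryDist hM₀
  have hμ₀pos : ∀ s ∈ C, 0 < μ₀ s := by
    intro s hs
    refine lt_of_le_of_ne (hμ₀.1.1 s) fun h => ?_
    have hz := hirr.forall_of_predecessor hM₀ hC (Z := fun x => μ₀ x = 0)
      (fun x _ y _ hxy hy => hμ₀.eq_zero_of_pos
        (fun _ _ => Matrix.nonneg_of_mem_rowStochastic hM₀) hy hxy) hs h.symm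
    have hz' : ∀ x, μ₀ x = 0 := fun x => by
      by_cases hx : x ∈ C
      exacts [hz x hx, hμ₀.eq_zero_of_isTransient hM₀ (htr x hx _ hπ)]
    have := hμ₀.1.2
    simp [hz'] at this
  obtain ⟨ε, hε, hεq⟩ :=
    exists_pos_mul_le_of_mem_intrinsicInterior hq (hμ₀.mul_mem_flowPolytope hπ)
  have hqpos : ∀ s ∈ C, ∀ a, 0 < π s a → 0 < q (s, a) := fun s hs a ha =>
    lt_of_lt_of_le (mul_pos hε (mul_pos (hμ₀pos s hs) ha)) (hεq (s, a))
  have hμpos : ∀ s ∈ C, 0 < μ s := by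
    intro s hs
    obtain ⟨a, -, ha⟩ := exists_lt_of_sum_lt (s := univ) (f := fun _ : A => (0 : ℝ)) (g := π s)
      (by simp [hπ.2])
    exact sum_pos' (fun a _ => hqP.1 _) ⟨a, mem_univ a, hqpos s hs a ha⟩
  have hoff : ∀ {ρ : S → ℝ}, IsStationaryDist M ρ → ∀ s ∉ C, ρ s = 0 := fun hρ s hs =>
    hρ.eq_zero_of_isTransient hM (htr s hs _ hπq)
  have hMpos : ∀ x ∈ C, ∀ y, 0 < markovMatrix P π x y → 0 < M x y := by
    intro x hx y hxy
    obtain ⟨a, -, ha⟩ := exists_lt_of_sum_lt (s := univ) (f := fun _ : A => (0 : ℝ))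
      (g := fun a => π x a * P x a y) (by simpa [markovMatrix] using hxy)
    have hπa : 0 < π x a := pos_of_mul_pos_left ha (hP.1 x a y)
    refine sum_pos' (fun a _ => mul_nonneg (hπq.1 x a) (hP.1 x a y)) ⟨a, mem_univ a, ?_⟩
    refine mul_pos ?_ (pos_of_mul_pos_right ha hπa.le)
    have := hqpos x hx a hπa
    rw [eq_mul_conditionalPolicy π hqP.1 x a] at this
    exact pos_of_mul_pos_right this (hμpos x hx).le
  obtain ⟨s₀, hs₀, hmin⟩ := Set.exists_min_image C (fun s => ν s / μ s) C.toFinite hCne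
  set t := ν s₀ / μ s₀ with ht
  have hσ0 : ∀ s, 0 ≤ ν s - t * μ s := fun s => by
    by_cases hs : s ∈ C
    · exact sub_nonneg.2 ((le_div_iff₀ (hμpos s hs)).1 (hmin s hs))
    · rw [hoff hν s hs, hoff hμ s hs]; simp
  have hσ : ∀ s, ∑ x, (ν x - t * μ x) * M x s = ν s - t * μ s := fun s => by
    simp_rw [sub_mul, sum_sub_distrib, mul_assoc, ← mul_sum]
    rw [hν.2, hμ.2]
  have hzC := hirr.forall_of_predecessor hM₀ hC (Z := fun x => ν x - t * μ x = 0)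
    (fun x hx y _ hxy hy => by
      have h := hσ y
      rw [hy, sum_eq_zero_iff_of_nonneg fun z _ =>
        mul_nonneg (hσ0 z) (Matrix.nonneg_of_mem_rowStochastic hM)] at h
      exact (mul_eq_zero.1 (h x (mem_univ x))).resolve_right (hMpos x hx y hxy).ne') hs₀
    (by rw [ht, div_mul_cancel₀ _ (hμpos s₀ hs₀).ne', sub_self])
  have hz : ∀ s, ν s = t * μ s := fun s => by
    by_cases hs : s ∈ C
    · exact sub_eq_zero.1 (hzC s hs)
    · rw [hoff hν s hs, hoff hμ s hs, mul_zero]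
  have ht1 : t = 1 := by
    have h := hν.1.2
    simp_rw [hz, ← mul_sum] at h
    rwa [hμ.1.2, mul_one] at h
  funext s
  rw [hz, ht1, one_mul]

end FlowPolytope

/-- **Geometric structure of the occupation measure set** for a weakly communicating MDP:
`relint(𝓟) ⊆ Q(s₁)`, `ext(𝓟) ⊆ Q(s₁)`, and `Q(s₁) ⊆ 𝓟`. -/
theorem occupation_set_geometry
    {S A : Type*} [Fintype S] [DecidableEq S] [Fintype A] [Nonempty S] [Nonempty A]
    (P : S → A → S → ℝ) (hP : IsKernel P) (hwc : WeaklyCommunicating P) (s₁ : S) :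
    intrinsicInterior ℝ (flowPolytope P) ⊆ occSet P s₁ ∧
    Set.extremePoints ℝ (flowPolytope P) ⊆ occSet P s₁ ∧
    occSet P s₁ ⊆ flowPolytope P := by
  exact ⟨intrinsicInterior_subset_occSet hP hwc s₁, extremePoints_subset_occSet hP hwc s₁,
    occSet_subset_flowPolytope hP s₁⟩
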